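/- arXiv:2204.08971 — 7 statements merged into one kernel-verified Lean document; each statement's English description precedes it below -/
import Mathlib

section
/- Let m, n be integers. The following are equivalent: (1) m = 1 or m = -1, or n = 1 or n = -1, or m + n = 1 or m + n = -1; (2) there exists a (unique) natural number x ≥ 0 such that m + n·ζ₆ is a unit multiple of x + ζ₆ or of its complex conjugate (x + 1) - ζ₆ in the Eisenstein integers; equivalently, there exist x : ℕ and k : ℕ such that m + n·ζ₆ = ζ₆^k · (x + ζ₆) or m + n·ζ₆ = ζ₆^k · ((x+1) - ζ₆). Moreover the natural number x in (2) is unique. -/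
/-- The primitive sixth root of unity `ζ₆ = (1 + √(-3))/2` in `ℂ`. -/
noncomputable def ζ₆ : ℂ := (1 + Real.sqrt 3 * Complex.I) / 2

lemma ζ₆_sq : ζ₆ ^ 2 = ζ₆ - 1 := by
  have h : ((Real.sqrt 3 : ℝ) : ℂ) ^ 2 = 3 := by
    exact_mod_cast congrArg (Complex.ofReal) (Real.sq_sqrt (show (0 : ℝ) ≤ 3 by norm_num))
  unfold ζ₆
  linear_combination (1 / 4 : ℂ) * Complex.I ^ 2 * h + (3 / 4 : ℂ) * Complex.I_sq

lemma ζ₆_im : ζ₆.im = Real.sqrt 3 / 2 := by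
  simp [ζ₆]

lemma intCast_add_mul_ζ₆_inj {m n a b : ℤ} :
    (m : ℂ) + n * ζ₆ = a + b * ζ₆ ↔ m = a ∧ n = b := by
  refine ⟨fun h => ?_, fun ⟨hm, hn⟩ => by rw [hm, hn]⟩
  have hn : n = b := by
    have him := congrArg Complex.im h
    simpa [ζ₆_im] using him
  subst hn
  exact ⟨by exact_mod_cast add_right_cancel h, rfl⟩

/-- The coordinates, in the basis `1, ζ₆`, of the multiples of `a + b·ζ₆` by powers of `ζ₆`. -/
lemma exists_eq_ζ₆_pow_mul_iff (m n a b : ℤ) :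
    (∃ k : ℕ, (m : ℂ) + n * ζ₆ = ζ₆ ^ k * (a + b * ζ₆)) ↔
      (m = a ∧ n = b) ∨ (m = -b ∧ n = a + b) ∨ (m = -a - b ∧ n = a) ∨
      (m = -a ∧ n = -b) ∨ (m = b ∧ n = -a - b) ∨ (m = a + b ∧ n = -a) := by
  have mul_ζ₆ (c d : ℤ) : ζ₆ * (c + d * ζ₆) = ((-d : ℤ) : ℂ) + ((c + d : ℤ) : ℂ) * ζ₆ := by
    push_cast
    linear_combination (d : ℂ) * ζ₆_sq
  constructor
  · rintro ⟨k, hk⟩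
    induction k generalizing a b with
    | zero =>
      rw [pow_zero, one_mul] at hk
      exact Or.inl (intCast_add_mul_ζ₆_inj.mp hk)
    | succ k ih =>
      rw [pow_succ, mul_assoc, mul_ζ₆] at hk
      rcases ih _ _ hk with h | h | h | h | h | h
      · exact Or.inr (Or.inl (by omega))
      · exact Or.inr (Or.inr (Or.inl (by omega)))
      · exact Or.inr (Or.inr (Or.inr (Or.inl (by omega))))
      · exact Or.inr (Or.inr (Or.inr (Or.inr (Or.inl (by omega)))))
      · exact Or.inr (Or.inr (Or.inr (Or.inr (Or.inr (by omega)))))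
      · exact Or.inl (by omega)
  · have cube : ζ₆ ^ 3 = -1 := by linear_combination (ζ₆ + 1) * ζ₆_sq
    rintro (⟨rfl, rfl⟩ | ⟨rfl, rfl⟩ | ⟨rfl, rfl⟩ | ⟨rfl, rfl⟩ | ⟨rfl, rfl⟩ | ⟨rfl, rfl⟩)
    · exact ⟨0, by simp⟩
    · exact ⟨1, by rw [pow_one, mul_ζ₆]⟩
    · exact ⟨2, by rw [pow_two, mul_assoc, mul_ζ₆, mul_ζ₆]; push_cast; ring⟩
    · exact ⟨3, by rw [cube]; push_cast; ring⟩
    · exact ⟨4, by rw [pow_succ, cube, mul_assoc, mul_ζ₆]; push_cast; ring⟩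
    · exact ⟨5, by
        rw [pow_add ζ₆ 3 2, cube, pow_two, mul_assoc, mul_assoc, mul_ζ₆, mul_ζ₆]
        push_cast; ring⟩

/-- The coordinates, in the basis `1, ζ₆`, of the unit multiples of `x + ζ₆` and its conjugate. -/
lemma exists_eq_ζ₆_pow_mul_or_conj_iff (m n : ℤ) (x : ℕ) :
    (∃ k : ℕ,
      (m : ℂ) + (n : ℂ) * ζ₆ = ζ₆ ^ k * ((x : ℂ) + ζ₆) ∨
      (m : ℂ) + (n : ℂ) * ζ₆ = ζ₆ ^ k * (((x : ℂ) + 1) - ζ₆)) ↔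
    ((m = x ∧ n = 1) ∨ (m = -1 ∧ n = x + 1) ∨ (m = -x - 1 ∧ n = x) ∨
      (m = -x ∧ n = -1) ∨ (m = 1 ∧ n = -x - 1) ∨ (m = x + 1 ∧ n = -x)) ∨
    ((m = x + 1 ∧ n = -1) ∨ (m = 1 ∧ n = x) ∨ (m = -x ∧ n = x + 1) ∨
      (m = -x - 1 ∧ n = 1) ∨ (m = -1 ∧ n = -x) ∨ (m = x ∧ n = -x - 1)) := by
  have h₁ := exists_eq_ζ₆_pow_mul_iff m n x 1
  have h₂ := exists_eq_ζ₆_pow_mul_iff m n (x + 1) (-1)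
  push_cast at h₁ h₂
  simp only [one_mul, neg_mul, ← sub_eq_add_neg] at h₁ h₂
  simp only [neg_add', sub_neg_eq_add, sub_add_cancel, add_sub_cancel_right] at h₂
  rw [exists_or]
  exact or_congr h₁ h₂

lemma norm_eq_of_exists_eq_ζ₆_pow_mul_or_conj {m n : ℤ} {x : ℕ}
    (h : ∃ k : ℕ,
      (m : ℂ) + (n : ℂ) * ζ₆ = ζ₆ ^ k * ((x : ℂ) + ζ₆) ∨
      (m : ℂ) + (n : ℂ) * ζ₆ = ζ₆ ^ k * (((x : ℂ) + 1) - ζ₆)) :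
    m ^ 2 + m * n + n ^ 2 = (x : ℤ) ^ 2 + x + 1 := by
  rcases (exists_eq_ζ₆_pow_mul_or_conj_iff m n x).mp h with
    (⟨rfl, rfl⟩ | ⟨rfl, rfl⟩ | ⟨rfl, rfl⟩ | ⟨rfl, rfl⟩ | ⟨rfl, rfl⟩ | ⟨rfl, rfl⟩) |
    (⟨rfl, rfl⟩ | ⟨rfl, rfl⟩ | ⟨rfl, rfl⟩ | ⟨rfl, rfl⟩ | ⟨rfl, rfl⟩ | ⟨rfl, rfl⟩) <;> ring

/-- For `m, n : ℤ`, the element `m + n·ζ₆` of the Eisenstein integers is a unit multiple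
of `x + ζ₆` or of its conjugate `(x+1) - ζ₆` for some (unique) natural number `x`
if and only if `m = ±1`, or `n = ±1`, or `m + n = ±1`.  (The units of `ℤ[ζ₆]` are
exactly the powers of `ζ₆`.) -/
theorem fundamental_lemma (m n : ℤ) :
    (m = 1 ∨ m = -1 ∨ n = 1 ∨ n = -1 ∨ m + n = 1 ∨ m + n = -1) ↔
      (∃! x : ℕ, ∃ k : ℕ,
        (m : ℂ) + (n : ℂ) * ζ₆ = ζ₆ ^ k * ((x : ℂ) + ζ₆) ∨
        (m : ℂ) + (n : ℂ) * ζ₆ = ζ₆ ^ k * (((x : ℂ) + 1) - ζ₆)) := by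
  constructor
  · intro h
    have nat_form (t : ℤ) : ∃ x : ℕ, t = x ∨ t = -x - 1 := by
      rcases le_or_gt 0 t with ht | ht
      · exact ⟨t.toNat, by omega⟩
      · exact ⟨(-t - 1).toNat, by omega⟩
    refine existsUnique_of_exists_of_unique ?_ fun x y hx hy => ?_
    · simp only [exists_eq_ζ₆_pow_mul_or_conj_iff]
      rcases h with h | h | h | h | h | h
      · obtain ⟨x, hx | hx⟩ := nat_form n
        · exact ⟨x, by simp [show m = 1 by omega, show n = x by omega]⟩
        · exact ⟨x, by simp [show m = 1 by omega, show n = -x - 1 by omega]⟩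
      · obtain ⟨x, hx | hx⟩ := nat_form (-n)
        · exact ⟨x, by simp [show m = -1 by omega, show n = -x by omega]⟩
        · exact ⟨x, by simp [show m = -1 by omega, show n = x + 1 by omega]⟩
      · obtain ⟨x, hx | hx⟩ := nat_form m
        · exact ⟨x, by simp [show m = x by omega, show n = 1 by omega]⟩
        · exact ⟨x, by simp [show m = -x - 1 by omega, show n = 1 by omega]⟩
      · obtain ⟨x, hx | hx⟩ := nat_form (-m)
        · exact ⟨x, by simp [show m = -x by omega, show n = -1 by omega]⟩
        · exact ⟨x, by simp [show m = x + 1 by omega, show n = -1 by omega]⟩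
      · obtain ⟨x, hx | hx⟩ := nat_form (-m)
        · exact ⟨x, by simp [show m = -x by omega, show n = x + 1 by omega]⟩
        · exact ⟨x, by simp [show m = x + 1 by omega, show n = -x by omega]⟩
      · obtain ⟨x, hx | hx⟩ := nat_form m
        · exact ⟨x, by simp [show m = x by omega, show n = -x - 1 by omega]⟩
        · exact ⟨x, by simp [show m = -x - 1 by omega, show n = x by omega]⟩
    · have norm_eq : (x : ℤ) ^ 2 + x + 1 = y ^ 2 + y + 1 :=
        (norm_eq_of_exists_eq_ζ₆_pow_mul_or_conj hx).symm.trans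
          (norm_eq_of_exists_eq_ζ₆_pow_mul_or_conj hy)
      have : (x : ℤ) = y := by nlinarith
      exact_mod_cast this
  · rintro ⟨x, hx, -⟩
    rw [exists_eq_ζ₆_pow_mul_or_conj_iff] at hx
    omega
end

section
/- Let x, a, b ≥ 1 be integers with a ≤ b such that a² + a + 1 and b² + b + 1 are both prime and x² + x + 1 = (a² + a + 1)(b² + b + 1). Then b = a + 1 and x = (a + 1)². -/
/-- If `x² + x + 1 = (a² + a + 1)(b² + b + 1)` with `1 ≤ a ≤ b` and both factors prime,
then `b = a + 1` and `x = (a + 1)²`. -/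
theorem two_factors (x a b : ℕ) (hx : 1 ≤ x) (ha : 1 ≤ a) (hb : 1 ≤ b) (hab : a ≤ b)
    (hpa : Nat.Prime (a ^ 2 + a + 1)) (hpb : Nat.Prime (b ^ 2 + b + 1))
    (heq : x ^ 2 + x + 1 = (a ^ 2 + a + 1) * (b ^ 2 + b + 1)) :
    b = a + 1 ∧ x = (a + 1) ^ 2 := by
  have hbx : b < x := by
    by_contra! h
    nlinarith [Nat.mul_le_mul h h, Nat.zero_le (b ^ 2 + b)]
  have hxq : x < b ^ 2 + b + 1 := by
    by_contra! h
    have hpq : a ^ 2 + a + 1 ≤ b ^ 2 + b + 1 := by gcongr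
    nlinarith [Nat.mul_le_mul h h, Nat.mul_le_mul_right (b ^ 2 + b + 1) hpq]
  obtain ⟨d, rfl⟩ := Nat.exists_eq_add_of_lt hbx
  have hdvd : b ^ 2 + b + 1 ∣ (d + 1) * (2 * b + d + 2) :=
    ⟨a ^ 2 + a, by linarith⟩
  have hxb : b + d + 1 = b ^ 2 := by
    rcases hpb.dvd_mul.mp hdvd with h | ⟨k, hk⟩
    · have := Nat.le_of_dvd (Nat.succ_pos d) h
      omega
    · have hk1 : k = 1 := by
        have : k < 2 := by
          by_contra! h
          nlinarith [Nat.mul_le_mul_left (b ^ 2 + b + 1) h]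
        interval_cases k <;> omega
      subst hk1
      omega
  obtain ⟨c, rfl⟩ := Nat.exists_eq_add_of_le' hb
  rw [hxb] at heq
  have hac : a ^ 2 + a + 1 = c ^ 2 + c + 1 :=
    Nat.eq_of_mul_eq_mul_right hpb.pos (by rw [← heq]; ring)
  have hac' : a = c := by
    rcases lt_trichotomy a c with h | h | h
    · nlinarith
    · exact h
    · nlinarith
  subst hac'
  exact ⟨rfl, hxb⟩
end

section
/- Let x, a, b, c ≥ 1 be integers such that a² + a + 1, b² + b + 1 and c² + c + 1 are all prime and x² + x + 1 = (a² + a + 1)(b² + b + 1)(c² + c + 1). Then, up to permuting a, b, c, either (a, b, c, x) is one of the three sporadic solutions (2, 2, 2, 18), (1, 2, 5, 25), (1, 3, 3, 22), or there is a permutation (a', b', c') of (a, b, c) with a' ≤ b' such that c'·(a' + b' + 1) = a'·b' and x = c'·(a'·b' + a' + b') + a' + b'. -/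
/-- If a prime `b² + b + 1` divides the Eisenstein norm `u² + uv + v²`, then `u - vω` is divisible
by `b - ω` or by its conjugate. -/
theorem exists_eisenstein_factor {b u v m : ℤ} (hp : Prime (b ^ 2 + b + 1))
    (h : u ^ 2 + u * v + v ^ 2 = (b ^ 2 + b + 1) * m) :
    ∃ s t : ℤ, s ^ 2 + s * t + t ^ 2 = m ∧
      ((u = b * s - t ∧ v = b * t + s + t) ∨ (u = (b + 1) * s + t ∧ v = b * t - s)) := by
  have hd : b ^ 2 + b + 1 ∣ (u - b * v) * (u + (b + 1) * v) :=
    ⟨m - v ^ 2, by linear_combination h⟩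
  rcases hp.dvd_or_dvd hd with ⟨k, hk⟩ | ⟨k, hk⟩
  · obtain rfl : u = b * v + (b ^ 2 + b + 1) * k := by linear_combination hk
    refine ⟨v + k * (b + 1), -k, mul_left_cancel₀ hp.ne_zero ?_, Or.inl ⟨by ring, by ring⟩⟩
    linear_combination h
  · obtain rfl : u = (b ^ 2 + b + 1) * k - (b + 1) * v := by linear_combination hk
    refine ⟨k * b - v, k, mul_left_cancel₀ hp.ne_zero ?_, Or.inr ⟨by ring, by ring⟩⟩
    linear_combination h

theorem eisenstein_unit_cases {s t : ℤ} (h : s ^ 2 + s * t + t ^ 2 = 1) :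
    (s = 1 ∧ t = 0) ∨ (s = -1 ∧ t = 0) ∨ (s = 0 ∧ t = 1) ∨ (s = 0 ∧ t = -1) ∨
      (s = 1 ∧ t = -1) ∨ (s = -1 ∧ t = 1) := by
  have h1 : s ≤ 1 := by nlinarith [sq_nonneg (s + 2 * t)]
  have h2 : -1 ≤ s := by nlinarith [sq_nonneg (s + 2 * t)]
  have h3 : t ≤ 1 := by nlinarith [sq_nonneg (2 * s + t)]
  have h4 : -1 ≤ t := by nlinarith [sq_nonneg (2 * s + t)]
  interval_cases s <;> interval_cases t <;> simp_all

/-- `x - ω` associated to `(a - ω)(b - ω)(c - ω)`. -/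
theorem eq_of_associated_same {x a b c s t : ℤ} (hx : 1 ≤ x) (ha : 1 ≤ a) (hb : 1 ≤ b)
    (hc : 1 ≤ c) (hst : s ^ 2 + s * t + t ^ 2 = 1)
    (h1 : x = (a * b * c - a - b - c - 1) * s - (a * b + b * c + c * a + a + b + c) * t)
    (h2 : 1 = (a * b * c - a - b - c - 1) * t + (a * b + b * c + c * a + a + b + c) * (s + t)) :
    a * b * c = a + b + c ∧ x = a * b + b * c + c * a + a + b + c - 1 := by
  have hab : 1 ≤ a * b := by nlinarith
  have hbc : 1 ≤ b * c := by nlinarith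
  have hca : 1 ≤ c * a := by nlinarith
  have habc : 1 ≤ a * b * c := by nlinarith
  rcases eisenstein_unit_cases hst with ⟨rfl, rfl⟩ | ⟨rfl, rfl⟩ | ⟨rfl, rfl⟩ | ⟨rfl, rfl⟩ |
    ⟨rfl, rfl⟩ | ⟨rfl, rfl⟩ <;> constructor <;> linarith

/-- The conjugate of `x - ω` associated to `(a - ω)(b - ω)(c - ω)`. -/
theorem eq_of_conj_associated_same {x a b c s t : ℤ} (hx : 1 ≤ x) (ha : 1 ≤ a) (hb : 1 ≤ b)
    (hc : 1 ≤ c) (hst : s ^ 2 + s * t + t ^ 2 = 1)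
    (h1 : x + 1 = (a * b * c - a - b - c - 1) * s - (a * b + b * c + c * a + a + b + c) * t)
    (h2 : -1 = (a * b * c - a - b - c - 1) * t + (a * b + b * c + c * a + a + b + c) * (s + t)) :
    a * b * c = a + b + c + 2 ∧ x = a * b + b * c + c * a + a + b + c := by
  have hab : 1 ≤ a * b := by nlinarith
  have hbc : 1 ≤ b * c := by nlinarith
  have hca : 1 ≤ c * a := by nlinarith
  have habc : 1 ≤ a * b * c := by nlinarith
  rcases eisenstein_unit_cases hst with ⟨rfl, rfl⟩ | ⟨rfl, rfl⟩ | ⟨rfl, rfl⟩ | ⟨rfl, rfl⟩ |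
    ⟨rfl, rfl⟩ | ⟨rfl, rfl⟩ <;> constructor <;> linarith

/-- `x - ω` associated to the product of `(a - ω)(b - ω)` and the conjugate of `c - ω`. -/
theorem eq_of_associated_mixed {x a b c s t : ℤ} (hx : 1 ≤ x) (ha : 1 ≤ a) (hb : 1 ≤ b)
    (hc : 1 ≤ c) (hst : s ^ 2 + s * t + t ^ 2 = 1)
    (h1 : x = (a * b * c + a * b + a + b - c) * s - (c * (a + b + 1) - a * b + 1) * t)
    (h2 : 1 = (a * b * c + a * b + a + b - c) * t + (c * (a + b + 1) - a * b + 1) * (s + t)) :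
    c * (a + b + 1) = a * b ∧ x = c * (a * b + a + b) + a + b := by
  have hab : 1 ≤ a * b := by nlinarith
  have hbc : 1 ≤ b * c := by nlinarith
  have hca : 1 ≤ c * a := by nlinarith
  have habc : c ≤ a * b * c := by nlinarith
  rcases eisenstein_unit_cases hst with ⟨rfl, rfl⟩ | ⟨rfl, rfl⟩ | ⟨rfl, rfl⟩ | ⟨rfl, rfl⟩ |
    ⟨rfl, rfl⟩ | ⟨rfl, rfl⟩ <;> constructor <;> linarith

/-- The conjugate of `x - ω` associated to the product of `(a - ω)(b - ω)` and the conjugate of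
`c - ω`. -/
theorem eq_of_conj_associated_mixed {x a b c s t : ℤ} (hx : 1 ≤ x) (ha : 1 ≤ a) (hb : 1 ≤ b)
    (hc : 1 ≤ c) (hst : s ^ 2 + s * t + t ^ 2 = 1)
    (h1 : x + 1 = (a * b * c + a * b + a + b - c) * s - (c * (a + b + 1) - a * b + 1) * t)
    (h2 : -1 = (a * b * c + a * b + a + b - c) * t + (c * (a + b + 1) - a * b + 1) * (s + t)) :
    c * (a + b + 1) + 2 = a * b ∧ x + 1 = a * b * c + a * b + a + b - c := by
  have hab : 1 ≤ a * b := by nlinarith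
  have hbc : 1 ≤ b * c := by nlinarith
  have hca : 1 ≤ c * a := by nlinarith
  have habc : c ≤ a * b * c := by nlinarith
  rcases eisenstein_unit_cases hst with ⟨rfl, rfl⟩ | ⟨rfl, rfl⟩ | ⟨rfl, rfl⟩ | ⟨rfl, rfl⟩ |
    ⟨rfl, rfl⟩ | ⟨rfl, rfl⟩ <;> constructor <;> linarith

/-- The conclusion of the classification, up to permutation of `a, b, c`. -/
def ThreeFactorSolution (x a b c : ℕ) : Prop :=
  ∃ a' b' c' : ℕ, ({a', b', c'} : Multiset ℕ) = ({a, b, c} : Multiset ℕ) ∧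
    ((a' = 2 ∧ b' = 2 ∧ c' = 2 ∧ x = 18) ∨
     (a' = 1 ∧ b' = 2 ∧ c' = 5 ∧ x = 25) ∨
     (a' = 1 ∧ b' = 3 ∧ c' = 3 ∧ x = 22) ∨
     (a' ≤ b' ∧ c' * (a' + b' + 1) = a' * b' ∧
        x = c' * (a' * b' + a' + b') + a' + b'))

theorem ThreeFactorSolution.congr {x a b c a' b' c' : ℕ} (h : ThreeFactorSolution x a b c)
    (hm : ({a, b, c} : Multiset ℕ) = {a', b', c'}) : ThreeFactorSolution x a' b' c' := by
  rw [ThreeFactorSolution] at h ⊢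
  rwa [← hm]

theorem ThreeFactorSolution.of_family {x a b c : ℕ} (h : c * (a + b + 1) = a * b)
    (hx : x = c * (a * b + a + b) + a + b) : ThreeFactorSolution x a b c := by
  rcases le_total a b with hab | hab
  · exact ⟨a, b, c, rfl, Or.inr (Or.inr (Or.inr ⟨hab, h, hx⟩))⟩
  · refine ⟨b, a, c, Multiset.cons_swap b a {c}, Or.inr (Or.inr (Or.inr ⟨hab, ?_, ?_⟩))⟩
    · linarith
    · rw [hx]; ring

theorem le_add_of_mul_mul_eq {a b c k : ℕ} (ha : 1 ≤ a) (hb : 1 ≤ b)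
    (h : a * b * c = a + b + c + k) : c ≤ k + 3 := by
  obtain ⟨a, rfl⟩ := Nat.exists_eq_add_of_le ha
  obtain ⟨b, rfl⟩ := Nat.exists_eq_add_of_le hb
  by_contra! hlt
  have hpos : 1 ≤ a + b + a * b := by
    by_contra! h0
    have : a = 0 := by lia
    have : b = 0 := by lia
    subst a b
    lia
  nlinarith

theorem ThreeFactorSolution.of_mul_eq_add {x a b c : ℕ} (ha : 1 ≤ a) (hb : 1 ≤ b) (hc : 1 ≤ c)
    (h : a * b * c = a + b + c) (hx : x + 1 = a * b + b * c + c * a + a + b + c) :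
    ThreeFactorSolution x a b c := by
  have hc3 : c ≤ 3 := le_add_of_mul_mul_eq (k := 0) ha hb (by lia)
  have hb3 : b ≤ 3 := le_add_of_mul_mul_eq (k := 0) hc ha (by linarith)
  have ha3 : a ≤ 3 := le_add_of_mul_mul_eq (k := 0) hb hc (by linarith)
  have hx16 : x = 16 := by interval_cases a <;> interval_cases b <;> interval_cases c <;> omega
  subst hx16
  refine ⟨2, 3, 1, ?_, by decide⟩
  interval_cases a <;> interval_cases b <;> interval_cases c <;> first | omega | decide

theorem ThreeFactorSolution.of_mul_eq_add_two {x a b c : ℕ} (ha : 1 ≤ a) (hb : 1 ≤ b)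
    (hc : 1 ≤ c) (h : a * b * c = a + b + c + 2) (hx : x = a * b + b * c + c * a + a + b + c) :
    ThreeFactorSolution x a b c := by
  have hc5 : c ≤ 5 := le_add_of_mul_mul_eq ha hb h
  have hb5 : b ≤ 5 := le_add_of_mul_mul_eq hc ha (by linarith)
  have ha5 : a ≤ 5 := le_add_of_mul_mul_eq hb hc (by linarith)
  subst hx
  interval_cases a <;> interval_cases b <;> interval_cases c <;> first
    | omega
    | exact ⟨2, 2, 2, by decide, by decide⟩
    | exact ⟨1, 2, 5, by decide, by decide⟩
    | exact ⟨1, 3, 3, by decide, by decide⟩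

theorem mod_three_ne_one_of_prime {a : ℕ} (ha : 1 < a) (hp : Nat.Prime (a ^ 2 + a + 1)) :
    a % 3 ≠ 1 := by
  intro h
  have hd : 3 ∣ a ^ 2 + a + 1 := by
    rw [Nat.dvd_iff_mod_eq_zero]
    simp [Nat.add_mod, Nat.pow_mod, h]
  have := (Nat.prime_dvd_prime_iff_eq Nat.prime_three hp).1 hd
  nlinarith

theorem ThreeFactorSolution.of_mul_add_two_eq {x a b c : ℕ} (hc : 1 ≤ c)
    (hpa : Nat.Prime (a ^ 2 + a + 1)) (hpb : Nat.Prime (b ^ 2 + b + 1))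
    (hpc : Nat.Prime (c ^ 2 + c + 1)) (h : c * (a + b + 1) + 2 = a * b)
    (hx : x + 1 + c = a * b * c + a * b + a + b) : ThreeFactorSolution x a b c := by
  have hca : c < a := by
    by_contra! hle
    nlinarith
  have hcb : c < b := by
    by_contra! hle
    nlinarith
  have ha3 := mod_three_ne_one_of_prime (hc.trans_lt hca) hpa
  have hb3 := mod_three_ne_one_of_prime (hc.trans_lt hcb) hpb
  have hmod : (c * (a + b + 1) + 2) % 3 = (a * b) % 3 := by rw [h]
  have hc1 : c = 1 := by
    by_contra hne
    have hc3 := mod_three_ne_one_of_prime (by lia) hpc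
    have h1 : a % 3 = 0 ∨ a % 3 = 2 := by lia
    have h2 : b % 3 = 0 ∨ b % 3 = 2 := by lia
    have h3 : c % 3 = 0 ∨ c % 3 = 2 := by lia
    rcases h1 with h1 | h1 <;> rcases h2 with h2 | h2 <;> rcases h3 with h3 | h3 <;>
      simp [Nat.add_mod, Nat.mul_mod, h1, h2, h3] at hmod
  subst hc1
  have ha5 : a ≤ 5 := by
    by_contra! hlt
    nlinarith
  interval_cases a
  · obtain rfl : b = 5 := by lia
    exact ⟨1, 2, 5, by decide, by lia⟩
  · obtain rfl : b = 3 := by lia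
    exact ⟨1, 3, 3, by decide, by lia⟩
  · lia
  · obtain rfl : b = 2 := by lia
    exact ⟨1, 2, 5, by decide, by lia⟩

theorem ThreeFactorSolution.of_associated_mixed {x a b c : ℕ} {s t : ℤ} (hx : 1 ≤ x)
    (ha : 1 ≤ a) (hb : 1 ≤ b) (hc : 1 ≤ c) (hst : s ^ 2 + s * t + t ^ 2 = 1)
    (h1 : (x : ℤ) = (a * b * c + a * b + a + b - c) * s - (c * (a + b + 1) - a * b + 1) * t)
    (h2 : 1 = (a * b * c + a * b + a + b - c) * t +
      (c * (a + b + 1) - a * b + 1) * (s + t : ℤ)) :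
    ThreeFactorSolution x a b c := by
  obtain ⟨h, h'⟩ := eq_of_associated_mixed (by lia) (by lia) (by lia) (by lia) hst h1 h2
  exact .of_family (by exact_mod_cast h) (by exact_mod_cast h')

theorem ThreeFactorSolution.of_conj_associated_mixed {x a b c : ℕ} {s t : ℤ} (hx : 1 ≤ x)
    (ha : 1 ≤ a) (hb : 1 ≤ b) (hc : 1 ≤ c) (hpa : Nat.Prime (a ^ 2 + a + 1))
    (hpb : Nat.Prime (b ^ 2 + b + 1)) (hpc : Nat.Prime (c ^ 2 + c + 1))
    (hst : s ^ 2 + s * t + t ^ 2 = 1)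
    (h1 : (x : ℤ) + 1 =
      (a * b * c + a * b + a + b - c) * s - (c * (a + b + 1) - a * b + 1) * t)
    (h2 : -1 = (a * b * c + a * b + a + b - c) * t +
      (c * (a + b + 1) - a * b + 1) * (s + t : ℤ)) :
    ThreeFactorSolution x a b c := by
  obtain ⟨h, h'⟩ := eq_of_conj_associated_mixed (by lia) (by lia) (by lia) (by lia) hst h1 h2
  exact .of_mul_add_two_eq hc hpa hpb hpc (by exact_mod_cast h) (by zify; linarith)



/-- Classification of solutions of `Φ₃(x) = Φ₃(a)Φ₃(b)Φ₃(c)` with all three factors prime: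
up to permutation, either one of three sporadic solutions, or a member of the infinite
family `c·(a+b+1) = a·b`, `x = c·(ab+a+b) + a + b`. -/
theorem three_factors (x a b c : ℕ) (hx : 1 ≤ x) (ha : 1 ≤ a) (hb : 1 ≤ b) (hc : 1 ≤ c)
    (hpa : Nat.Prime (a ^ 2 + a + 1)) (hpb : Nat.Prime (b ^ 2 + b + 1))
    (hpc : Nat.Prime (c ^ 2 + c + 1))
    (heq : x ^ 2 + x + 1 = (a ^ 2 + a + 1) * (b ^ 2 + b + 1) * (c ^ 2 + c + 1)) :
    ∃ a' b' c' : ℕ, ({a', b', c'} : Multiset ℕ) = ({a, b, c} : Multiset ℕ) ∧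
      ((a' = 2 ∧ b' = 2 ∧ c' = 2 ∧ x = 18) ∨
       (a' = 1 ∧ b' = 2 ∧ c' = 5 ∧ x = 25) ∨
       (a' = 1 ∧ b' = 3 ∧ c' = 3 ∧ x = 22) ∨
       (a' ≤ b' ∧ c' * (a' + b' + 1) = a' * b' ∧
          x = c' * (a' * b' + a' + b') + a' + b')) := by
  change ThreeFactorSolution x a b c
  have hpa' : Prime ((a : ℤ) ^ 2 + a + 1) := by exact_mod_cast Nat.prime_iff_prime_int.1 hpa
  have hpb' : Prime ((b : ℤ) ^ 2 + b + 1) := by exact_mod_cast Nat.prime_iff_prime_int.1 hpb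
  have hpc' : Prime ((c : ℤ) ^ 2 + c + 1) := by exact_mod_cast Nat.prime_iff_prime_int.1 hpc
  have hnorm : (x : ℤ) ^ 2 + x * 1 + 1 ^ 2 =
      (a ^ 2 + a + 1) * ((b ^ 2 + b + 1) * ((c ^ 2 + c + 1) * 1)) := by
    zify at heq
    linear_combination heq
  obtain ⟨u, v, huv, hA⟩ := exists_eisenstein_factor hpa' hnorm
  obtain ⟨y, z, hyz, hB⟩ := exists_eisenstein_factor hpb' huv
  obtain ⟨s, t, hst, hC⟩ := exists_eisenstein_factor hpc' hyz
  have hst' : (s + t) ^ 2 + (s + t) * (-t) + (-t) ^ 2 = 1 := by linear_combination hst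
  have hacb : ({a, c, b} : Multiset ℕ) = {a, b, c} :=
    congrArg (Multiset.cons a) (Multiset.cons_swap c b 0)
  have hbca : ({b, c, a} : Multiset ℕ) = {a, b, c} := by
    rw [← hacb]
    exact (congrArg (Multiset.cons b) (Multiset.cons_swap c a 0)).trans
      ((Multiset.cons_swap b a {c}).trans hacb.symm)
  rcases hC with ⟨rfl, rfl⟩ | ⟨rfl, rfl⟩ <;> rcases hB with ⟨rfl, rfl⟩ | ⟨rfl, rfl⟩ <;>
    rcases hA with ⟨h1, h2⟩ | ⟨h1, h2⟩
  · obtain ⟨h, h'⟩ := eq_of_associated_same (x := x) (a := a) (b := b) (c := c) (by lia) (by lia)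
      (by lia) (by lia) hst (by linear_combination h1) (by linear_combination h2)
    exact .of_mul_eq_add ha hb hc (by exact_mod_cast h) (by zify; linarith)
  · exact (ThreeFactorSolution.of_associated_mixed hx hb hc ha hst (by linear_combination h1)
      (by linear_combination h2)).congr hbca
  · exact (ThreeFactorSolution.of_associated_mixed hx ha hc hb hst (by linear_combination h1)
      (by linear_combination h2)).congr hacb
  · exact .of_conj_associated_mixed hx ha hb hc hpa hpb hpc hst'
      (by linear_combination h1 + h2) (by linear_combination -h2)
  · exact .of_associated_mixed hx ha hb hc hst (by linear_combination h1)
      (by linear_combination h2)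
  · exact (ThreeFactorSolution.of_conj_associated_mixed hx ha hc hb hpa hpc hpb hst'
      (by linear_combination h1 + h2) (by linear_combination -h2)).congr hacb
  · exact (ThreeFactorSolution.of_conj_associated_mixed hx hb hc ha hpb hpc hpa hst'
      (by linear_combination h1 + h2) (by linear_combination -h2)).congr hbca
  · obtain ⟨h, h'⟩ := eq_of_conj_associated_same (x := x) (a := a) (b := b) (c := c) (by lia)
      (by lia) (by lia) (by lia) hst' (by linear_combination h1 + h2) (by linear_combination -h2)
    exact .of_mul_eq_add_two ha hb hc (by exact_mod_cast h) (by exact_mod_cast h')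
end

section
/- Let a and b be prime numbers such that a + b + 1 divides a·b, and set c = a·b / (a + b + 1). Then c is a positive integer that is not prime. (Indeed c < a and c < b, while the only prime factors of a·b are a and b.) -/
/-- If `a` and `b` are primes and `a + b + 1` divides `a·b`, then `c = a·b/(a+b+1)` is a
positive integer that is not prime. -/
theorem family_entry_not_prime (a b : ℕ) (hpa : Nat.Prime a) (hpb : Nat.Prime b)
    (hdvd : (a + b + 1) ∣ a * b) :
    0 < a * b / (a + b + 1) ∧ ¬ Nat.Prime (a * b / (a + b + 1)) := by
  obtain ⟨c, hc⟩ := hdvd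
  rw [hc, Nat.mul_div_cancel_left c (by lia)]
  refine ⟨Nat.pos_of_ne_zero ?_, fun hpc => ?_⟩
  · rintro rfl
    exact mul_ne_zero hpa.ne_zero hpb.ne_zero hc
  · rcases hpc.dvd_mul.1 (hc ▸ dvd_mul_left c _) with h | h
    · obtain rfl := (Nat.prime_dvd_prime_iff_eq hpc hpa).1 h
      nlinarith [hpc.pos]
    · obtain rfl := (Nat.prime_dvd_prime_iff_eq hpc hpb).1 h
      nlinarith [hpc.pos]
end

section
/- Let x, a, b, c, d ≥ 1 be integers such that a² + a + 1, b² + b + 1, c² + c + 1 and d² + d + 1 are all prime and x² + x + 1 = (a² + a + 1)(b² + b + 1)(c² + c + 1)(d² + d + 1). Then there is a permutation (a', b', c', d') of (a, b, c, d) such that either (a', b', c', d') is one of the two sporadic solutions (2, 2, 2, 17) or (2, 2, 3, 6), or one of the following four relations holds: (i) a' ≤ b' ≤ c' and d'·(a'b' + a'c' + b'c' + a' + b' + c') = a'b'c' − a' − b' − c' − 2; (ii) a' ≤ b' ≤ c' and d'·(a'b' + a'c' + b'c' + a' + b' + c') = a'b'c' − a' − b' − c'; (iii) a' ≤ b', a'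 ≤ c' and d'·(a'c' + b'c' − a'b' + c' + 1) = a'b'c' + a'b' + a' + b' − c' − 1; (iv) a' ≤ b', a' ≤ c' and d'·(a'c' + b'c' − a'b' + c' + 1) = a'b'c' + a'b' + a' + b' − c' + 1. -/
/-- With `e₁, …, e₄` the elementary symmetric functions of `p, q, r, s`, the product
`(p - ω)(q - ω)(r - ω)(s - ω)` in `ℤ[ω]` is `A + B ω` with `A = e₄ - e₂ - e₁` and
`B = 1 - e₃ - e₂`. This says that some associate of it has `ω`-coordinate `±1`. -/
def HasUnitCoordinate (p q r s : ℤ) : Prop :=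
  p * q * r * s - (p * q + p * r + p * s + q * r + q * s + r * s) - (p + q + r + s) = 1 ∨
  p * q * r * s - (p * q + p * r + p * s + q * r + q * s + r * s) - (p + q + r + s) = -1 ∨
  1 - (p * q * r + p * q * s + p * r * s + q * r * s) -
    (p * q + p * r + p * s + q * r + q * s + r * s) = 1 ∨
  1 - (p * q * r + p * q * s + p * r * s + q * r * s) -
    (p * q + p * r + p * s + q * r + q * s + r * s) = -1 ∨
  p * q * r * s + (p * q * r + p * q * s + p * r * s + q * r * s) - (p + q + r + s) - 1 = 1 ∨
  p * q * r * s + (p * q * r + p * q * s + p * r * s + q * r * s) - (p + q + r + s) - 1 = -1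

namespace HasUnitCoordinate

variable {p q r s : ℤ}

theorem swap₁₂ (h : HasUnitCoordinate p q r s) : HasUnitCoordinate q p r s := by
  unfold HasUnitCoordinate at *
  ring_nf at *
  exact h

theorem swap₂₃ (h : HasUnitCoordinate p q r s) : HasUnitCoordinate p r q s := by
  unfold HasUnitCoordinate at *
  ring_nf at *
  exact h

theorem swap₃₄ (h : HasUnitCoordinate p q r s) : HasUnitCoordinate p q s r := by
  unfold HasUnitCoordinate at *
  ring_nf at *
  exact h

/-- Complex conjugation sends `p - ω` to `-((-1 - p) - ω)`. -/
theorem conj (h : HasUnitCoordinate p q r s) :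
    HasUnitCoordinate (-1 - p) (-1 - q) (-1 - r) (-1 - s) := by
  unfold HasUnitCoordinate at *
  rcases h with h | h | h | h | h | h
  · right; right; right; right; left; linear_combination h
  · right; right; right; right; right; linear_combination h
  · right; right; right; left; linear_combination -h
  · right; right; left; linear_combination -h
  · left; linear_combination h
  · right; left; linear_combination h

/-- The element `1 - ω` is associated to its conjugate. -/
theorem flip_one (h : HasUnitCoordinate 1 q r s) : HasUnitCoordinate (-1 - 1) q r s := by
  unfold HasUnitCoordinate at *
  rcases h with h | h | h | h | h | h
  · right; right; right; left; linear_combination -h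
  · right; right; left; linear_combination -h
  · right; right; right; right; left; linear_combination h
  · right; right; right; right; right; linear_combination h
  · right; left; linear_combination -h
  · left; linear_combination -h

end HasUnitCoordinate

/-- Up to permutation, `(a, b, c, d)` is a sporadic solution or lies in one of the families. -/
def IsListed (a b c d : ℕ) : Prop :=
    ∃ a' b' c' d' : ℕ,
      ({a', b', c', d'} : Multiset ℕ) = ({a, b, c, d} : Multiset ℕ) ∧
      ((a' = 2 ∧ b' = 2 ∧ c' = 2 ∧ d' = 17) ∨
       (a' = 2 ∧ b' = 2 ∧ c' = 3 ∧ d' = 6) ∨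
       (a' ≤ b' ∧ b' ≤ c' ∧
         (d' : ℤ) * ((a' : ℤ) * b' + a' * c' + b' * c' + a' + b' + c') =
           (a' : ℤ) * b' * c' - a' - b' - c' - 2) ∨
       (a' ≤ b' ∧ b' ≤ c' ∧
         (d' : ℤ) * ((a' : ℤ) * b' + a' * c' + b' * c' + a' + b' + c') =
           (a' : ℤ) * b' * c' - a' - b' - c') ∨
       (a' ≤ b' ∧ a' ≤ c' ∧
         (d' : ℤ) * ((a' : ℤ) * c' + b' * c' - a' * b' + c' + 1) =
           (a' : ℤ) * b' * c' + a' * b' + a' + b' - c' - 1) ∨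
       (a' ≤ b' ∧ a' ≤ c' ∧
         (d' : ℤ) * ((a' : ℤ) * c' + b' * c' - a' * b' + c' + 1) =
           (a' : ℤ) * b' * c' + a' * b' + a' + b' - c' + 1))

namespace IsListed

variable {a b c d : ℕ}

theorem swap₁₂ (h : IsListed a b c d) : IsListed b a c d := by
  obtain ⟨a', b', c', d', hm, h⟩ := h
  exact ⟨a', b', c', d', hm.trans (Multiset.cons_swap a b _), h⟩

theorem swap₂₃ (h : IsListed a b c d) : IsListed a c b d := by
  obtain ⟨a', b', c', d', hm, h⟩ := h
  exact ⟨a', b', c', d', hm.trans (congrArg (a ::ₘ ·) (Multiset.cons_swap b c _)), h⟩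

theorem swap₃₄ (h : IsListed a b c d) : IsListed a b d c := by
  obtain ⟨a', b', c', d', hm, h⟩ := h
  exact ⟨a', b', c', d',
    hm.trans (congrArg (fun t ↦ a ::ₘ b ::ₘ t) (Multiset.cons_swap c d 0)), h⟩

/-- Two of the factors are conjugated. -/
theorem of_two_conj (ha : 1 ≤ a) (hb : 1 ≤ b) (hc : 1 ≤ c) (hd : 1 ≤ d)
    (h : HasUnitCoordinate a b (-1 - c) (-1 - d)) : IsListed a b c d := by
  wlog hab : a ≤ b generalizing a b
  · exact (this hb ha h.swap₁₂ (by omega)).swap₁₂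
  wlog hcd : c ≤ d generalizing c d
  · exact (this hd hc h.swap₃₄ (by omega)).swap₃₄
  wlog hac : a ≤ c generalizing a b c d
  · refine (this (a := c) (b := d) (c := a) (d := b) hc hd hcd ha hb ?_ hab
      (by omega)).swap₂₃.swap₁₂.swap₃₄.swap₂₃
    simpa using h.conj.swap₂₃.swap₁₂.swap₃₄.swap₂₃
  refine ⟨a, b, c, d, rfl, ?_⟩
  obtain ⟨a, rfl⟩ := Nat.exists_eq_add_of_le ha
  obtain ⟨b, rfl⟩ := Nat.exists_eq_add_of_le hb
  obtain ⟨c, rfl⟩ := Nat.exists_eq_add_of_le hc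
  obtain ⟨d, rfl⟩ := Nat.exists_eq_add_of_le hd
  push_cast [HasUnitCoordinate] at *
  rcases h with h | h | h | h | h | h
  · exfalso; ring_nf at h; norm_cast at h; omega
  · exfalso; ring_nf at h; norm_cast at h
  · right; right; right; right; left; exact ⟨hab, hac, by linear_combination -h⟩
  · right; right; right; right; right; exact ⟨hab, hac, by linear_combination -h⟩
  · exfalso; ring_nf at h; norm_cast at h; omega
  · exfalso; ring_nf at h; norm_cast at h

/-- One factor is conjugated. -/
theorem of_one_conj (ha : 1 ≤ a) (hb : 1 ≤ b) (hc : 1 ≤ c) (hd : 1 ≤ d)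
    (h : HasUnitCoordinate a b c (-1 - d)) : IsListed a b c d := by
  wlog hab : a ≤ b generalizing a b
  · exact (this hb ha h.swap₁₂ (by omega)).swap₁₂
  wlog hbc : b ≤ c generalizing a b c
  · obtain hac | hac := le_total a c
    · apply IsListed.swap₂₃
      apply this <;> first | omega | exact h.swap₂₃
    · apply IsListed.swap₂₃
      apply IsListed.swap₁₂
      apply this <;> first | omega | exact h.swap₂₃.swap₁₂
  obtain rfl | ha2 := ha.eq_or_lt
  · refine (of_two_conj hb hc le_rfl hd ?_).swap₂₃.swap₁₂
    exact (HasUnitCoordinate.flip_one (by simpa using h)).swap₁₂.swap₂₃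
  replace ha2 : 2 ≤ a := ha2
  refine ⟨a, b, c, d, rfl, ?_⟩
  obtain ⟨a, rfl⟩ := Nat.exists_eq_add_of_le ha2
  obtain ⟨b, rfl⟩ := Nat.exists_eq_add_of_le (ha2.trans hab)
  obtain ⟨c, rfl⟩ := Nat.exists_eq_add_of_le ((ha2.trans hab).trans hbc)
  obtain ⟨d, rfl⟩ := Nat.exists_eq_add_of_le hd
  push_cast [HasUnitCoordinate] at *
  rcases h with h | h | h | h | h | h
  · exfalso; rw [← neg_inj] at h; ring_nf at h; norm_cast at h
  · exfalso; rw [← neg_inj] at h; ring_nf at h; norm_cast at h; omega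
  · right; right; right; left; exact ⟨hab, hbc, by linear_combination h⟩
  · right; right; left; exact ⟨hab, hbc, by linear_combination h⟩
  · exfalso; rw [← neg_inj] at h; ring_nf at h; norm_cast at h
  · exfalso; rw [← neg_inj] at h; ring_nf at h; norm_cast at h; omega

/-- No factor is conjugated. -/
theorem of_no_conj (ha : 1 ≤ a) (hb : 1 ≤ b) (hc : 1 ≤ c) (hd : 1 ≤ d)
    (ha19 : a ≠ 19) (hb19 : b ≠ 19) (hc19 : c ≠ 19) (hd19 : d ≠ 19)
    (h : HasUnitCoordinate a b c d) : IsListed a b c d := by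
  wlog hab : a ≤ b generalizing a b
  · apply IsListed.swap₁₂
    apply this <;> first | omega | exact h.swap₁₂
  wlog hbc : b ≤ c generalizing a b c
  · obtain hac | hac := le_total a c
    · apply IsListed.swap₂₃
      apply this <;> first | omega | exact h.swap₂₃
    · apply IsListed.swap₂₃
      apply IsListed.swap₁₂
      apply this <;> first | omega | exact h.swap₂₃.swap₁₂
  wlog hcd : c ≤ d generalizing a b c d
  · apply IsListed.swap₃₄
    obtain hbd | hbd := le_total b d
    · apply this <;> first | omega | exact h.swap₃₄
    apply IsListed.swap₂₃
    obtain had | had := le_total a d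
    · apply this <;> first | omega | exact h.swap₃₄.swap₂₃
    apply IsListed.swap₁₂
    apply this <;> first | omega | exact h.swap₃₄.swap₂₃.swap₁₂
  obtain rfl | ha2 := ha.eq_or_lt
  · refine (of_one_conj hb hc hd le_rfl ?_).swap₃₄.swap₂₃.swap₁₂
    exact (HasUnitCoordinate.flip_one (by simpa using h)).swap₁₂.swap₂₃.swap₃₄
  replace ha2 : 2 ≤ a := ha2
  have key : (a * b * c * d : ℤ) - (a * b + a * c + a * d + b * c + b * d + c * d) -
      (a + b + c + d) = 1 ∨ (a * b * c * d : ℤ) -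
      (a * b + a * c + a * d + b * c + b * d + c * d) - (a + b + c + d) = -1 := by
    obtain ⟨a, rfl⟩ := Nat.exists_eq_add_of_le ha2
    obtain ⟨b, rfl⟩ := Nat.exists_eq_add_of_le (ha2.trans hab)
    obtain ⟨c, rfl⟩ := Nat.exists_eq_add_of_le ((ha2.trans hab).trans hbc)
    obtain ⟨d, rfl⟩ := Nat.exists_eq_add_of_le (((ha2.trans hab).trans hbc).trans hcd)
    push_cast [HasUnitCoordinate] at *
    rcases h with h | h | h | h | h | h
    · exact .inl h
    · exact .inr h
    · exfalso; rw [← neg_inj] at h; ring_nf at h; norm_cast at h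
    · exfalso; rw [← neg_inj] at h; ring_nf at h; norm_cast at h; omega
    · exfalso; ring_nf at h; norm_cast at h; omega
    · exfalso; ring_nf at h; norm_cast at h
  clear h
  obtain rfl | ha3 := ha2.eq_or_lt
  · have hb3 : b ≤ 3 := by
      by_contra! hb4
      replace hb4 : 4 ≤ b := hb4
      obtain ⟨b, rfl⟩ := Nat.exists_eq_add_of_le hb4
      obtain ⟨c, rfl⟩ := Nat.exists_eq_add_of_le (hb4.trans hbc)
      obtain ⟨d, rfl⟩ := Nat.exists_eq_add_of_le ((hb4.trans hbc).trans hcd)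
      push_cast at key
      rcases key with h | h
      · ring_nf at h; norm_cast at h; omega
      · ring_nf at h; norm_cast at h
    have hc4 : c ≤ 4 := by
      by_contra! hc5
      replace hc5 : 5 ≤ c := hc5
      obtain ⟨c, rfl⟩ := Nat.exists_eq_add_of_le hc5
      obtain ⟨d, rfl⟩ := Nat.exists_eq_add_of_le (hc5.trans hcd)
      push_cast at key
      interval_cases b
      all_goals
        rcases key with h | h
        · ring_nf at h; norm_cast at h; omega
        · ring_nf at h; norm_cast at h
    interval_cases b <;> interval_cases c <;> norm_num at key
    · obtain rfl : d = 17 := by omega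
      exact ⟨2, 2, 2, 17, rfl, by simp⟩
    · obtain rfl : d = 6 := by omega
      exact ⟨2, 2, 3, 6, rfl, by simp⟩
    all_goals omega
  · exfalso
    replace ha3 : 3 ≤ a := ha3
    obtain ⟨a, rfl⟩ := Nat.exists_eq_add_of_le ha3
    obtain ⟨b, rfl⟩ := Nat.exists_eq_add_of_le (ha3.trans hab)
    obtain ⟨c, rfl⟩ := Nat.exists_eq_add_of_le ((ha3.trans hab).trans hbc)
    obtain ⟨d, rfl⟩ := Nat.exists_eq_add_of_le (((ha3.trans hab).trans hbc).trans hcd)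
    push_cast at key
    rcases key with h | h
    · ring_nf at h; norm_cast at h; omega
    · ring_nf at h; norm_cast at h

end IsListed

/-- If the prime `a ^ 2 + a + 1 = N(a - ω)` divides `N(u + v ω)`, then `u + v ω` is divisible
by `a - ω` or by its conjugate. -/
theorem exists_eisenstein_quotient {a : ℕ} {u v n : ℤ} (hp : Nat.Prime (a ^ 2 + a + 1))
    (h : u ^ 2 - u * v + v ^ 2 = (a ^ 2 + a + 1) * n) :
    ∃ s u' v' : ℤ, (s = a ∨ s = -1 - a) ∧ u' ^ 2 - u' * v' + v' ^ 2 = n ∧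
      u = s * u' + v' ∧ v = s * v' - u' + v' := by
  have hp' : Prime ((a : ℤ) ^ 2 + a + 1) := by exact_mod_cast Nat.prime_iff_prime_int.mp hp
  have key (s : ℤ) (hs : s ^ 2 + s + 1 = (a : ℤ) ^ 2 + a + 1)
      (hdvd : (a : ℤ) ^ 2 + a + 1 ∣ u + s * v) : ∃ u' v' : ℤ, u' ^ 2 - u' * v' + v' ^ 2 = n ∧
      u = s * u' + v' ∧ v = s * v' - u' + v' := by
    rw [← hs] at hdvd h
    obtain ⟨k, hk⟩ := hdvd
    have h0 : s ^ 2 + s + 1 ≠ 0 := by rw [hs]; positivity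
    have hu : u = s * ((s + 1) * k - v) + k := by linear_combination hk
    refine ⟨(s + 1) * k - v, k, ?_, hu, by ring⟩
    apply mul_left_cancel₀ h0
    rw [← h, hu]
    ring
  have hdvd : (a : ℤ) ^ 2 + a + 1 ∣ (u + a * v) * (u + (-1 - a) * v) :=
    ⟨n - v ^ 2, by linear_combination h⟩
  rcases hp'.dvd_or_dvd hdvd with hd | hd
  · obtain ⟨u', v', h'⟩ := key a rfl hd
    exact ⟨a, u', v', .inl rfl, h'⟩
  · obtain ⟨u', v', h'⟩ := key (-1 - a) (by ring) hd
    exact ⟨-1 - a, u', v', .inr rfl, h'⟩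

/-- The elements of norm one in `ℤ[ω]`. -/
theorem eisenstein_norm_eq_one {u v : ℤ} (h : u ^ 2 - u * v + v ^ 2 = 1) :
    (u = 1 ∧ v = 0) ∨ (u = -1 ∧ v = 0) ∨ (u = 0 ∧ v = 1) ∨ (u = 0 ∧ v = -1) ∨
      (u = 1 ∧ v = 1) ∨ (u = -1 ∧ v = -1) := by
  have h1 : -1 ≤ u := by nlinarith [sq_nonneg (u - 2 * v)]
  have h2 : u ≤ 1 := by nlinarith [sq_nonneg (u - 2 * v)]
  have h3 : -1 ≤ v := by nlinarith [sq_nonneg (v - 2 * u)]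
  have h4 : v ≤ 1 := by nlinarith [sq_nonneg (v - 2 * u)]
  interval_cases u <;> interval_cases v <;> simp_all

theorem exists_hasUnitCoordinate {x a b c d : ℕ}
    (hpa : Nat.Prime (a ^ 2 + a + 1)) (hpb : Nat.Prime (b ^ 2 + b + 1))
    (hpc : Nat.Prime (c ^ 2 + c + 1)) (hpd : Nat.Prime (d ^ 2 + d + 1))
    (heq : x ^ 2 + x + 1 =
      (a ^ 2 + a + 1) * (b ^ 2 + b + 1) * (c ^ 2 + c + 1) * (d ^ 2 + d + 1)) :
    ∃ p q r s : ℤ, (p = a ∨ p = -1 - a) ∧ (q = b ∨ q = -1 - b) ∧ (r = c ∨ r = -1 - c) ∧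
      (s = d ∨ s = -1 - d) ∧ HasUnitCoordinate p q r s := by
  have hx : (x : ℤ) ^ 2 - x * (-1) + (-1) ^ 2 = (a ^ 2 + a + 1) *
      ((b ^ 2 + b + 1) * ((c ^ 2 + c + 1) * ((d ^ 2 + d + 1) * 1))) := by
    zify at heq
    linear_combination heq
  obtain ⟨p, u₁, v₁, hp, h₁, -, e₁⟩ := exists_eisenstein_quotient hpa hx
  obtain ⟨q, u₂, v₂, hq, h₂, rfl, rfl⟩ := exists_eisenstein_quotient hpb h₁
  obtain ⟨r, u₃, v₃, hr, h₃, rfl, rfl⟩ := exists_eisenstein_quotient hpc h₂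
  obtain ⟨s, u₄, v₄, hs, h₄, rfl, rfl⟩ := exists_eisenstein_quotient hpd h₃
  refine ⟨p, q, r, s, hp, hq, hr, hs, ?_⟩
  unfold HasUnitCoordinate
  rcases eisenstein_norm_eq_one h₄ with
    ⟨rfl, rfl⟩ | ⟨rfl, rfl⟩ | ⟨rfl, rfl⟩ | ⟨rfl, rfl⟩ | ⟨rfl, rfl⟩ | ⟨rfl, rfl⟩
  · right; right; right; left; linear_combination -e₁
  · right; right; left; linear_combination e₁
  · right; right; right; right; right; linear_combination -e₁
  · right; right; right; right; left; linear_combination e₁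
  · right; left; linear_combination -e₁
  · left; linear_combination e₁


/-- Classification of solutions of `Φ₃(x) = Φ₃(a)Φ₃(b)Φ₃(c)Φ₃(d)` with all four factors
prime: up to permutation, one of two sporadic solutions, or a member of one of four
infinite families. -/
theorem four_factors (x a b c d : ℕ) (hx : 1 ≤ x) (ha : 1 ≤ a) (hb : 1 ≤ b)
    (hc : 1 ≤ c) (hd : 1 ≤ d)
    (hpa : Nat.Prime (a ^ 2 + a + 1)) (hpb : Nat.Prime (b ^ 2 + b + 1))
    (hpc : Nat.Prime (c ^ 2 + c + 1)) (hpd : Nat.Prime (d ^ 2 + d + 1))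
    (heq : x ^ 2 + x + 1 =
      (a ^ 2 + a + 1) * (b ^ 2 + b + 1) * (c ^ 2 + c + 1) * (d ^ 2 + d + 1)) :
    ∃ a' b' c' d' : ℕ,
      ({a', b', c', d'} : Multiset ℕ) = ({a, b, c, d} : Multiset ℕ) ∧
      ((a' = 2 ∧ b' = 2 ∧ c' = 2 ∧ d' = 17) ∨
       (a' = 2 ∧ b' = 2 ∧ c' = 3 ∧ d' = 6) ∨
       (a' ≤ b' ∧ b' ≤ c' ∧
         (d' : ℤ) * ((a' : ℤ) * b' + a' * c' + b' * c' + a' + b' + c') =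
           (a' : ℤ) * b' * c' - a' - b' - c' - 2) ∨
       (a' ≤ b' ∧ b' ≤ c' ∧
         (d' : ℤ) * ((a' : ℤ) * b' + a' * c' + b' * c' + a' + b' + c') =
           (a' : ℤ) * b' * c' - a' - b' - c') ∨
       (a' ≤ b' ∧ a' ≤ c' ∧
         (d' : ℤ) * ((a' : ℤ) * c' + b' * c' - a' * b' + c' + 1) =
           (a' : ℤ) * b' * c' + a' * b' + a' + b' - c' - 1) ∨
       (a' ≤ b' ∧ a' ≤ c' ∧
         (d' : ℤ) * ((a' : ℤ) * c' + b' * c' - a' * b' + c' + 1) =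
           (a' : ℤ) * b' * c' + a' * b' + a' + b' - c' + 1)) := by
  change IsListed a b c d
  have ne19 {n : ℕ} (hn : Nat.Prime (n ^ 2 + n + 1)) : n ≠ 19 := by
    rintro rfl
    norm_num at hn
  obtain ⟨p, q, r, s, hp, hq, hr, hs, h⟩ := exists_hasUnitCoordinate hpa hpb hpc hpd heq
  have hconj := h.conj
  rcases hp with rfl | rfl <;> rcases hq with rfl | rfl <;> rcases hr with rfl | rfl <;>
    rcases hs with rfl | rfl <;>
    try simp only [sub_sub_cancel] at hconj
  · exact .of_no_conj ha hb hc hd (ne19 hpa) (ne19 hpb) (ne19 hpc) (ne19 hpd) h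
  · exact .of_one_conj ha hb hc hd h
  · exact (IsListed.of_one_conj ha hb hd hc h.swap₃₄).swap₃₄
  · exact .of_two_conj ha hb hc hd h
  · exact (IsListed.of_one_conj ha hc hd hb h.swap₂₃.swap₃₄).swap₃₄.swap₂₃
  · exact (IsListed.of_two_conj ha hc hb hd h.swap₂₃).swap₂₃
  · exact (IsListed.of_two_conj ha hd hb hc h.swap₃₄.swap₂₃).swap₂₃.swap₃₄
  · exact (IsListed.of_one_conj hb hc hd ha
      hconj.swap₁₂.swap₂₃.swap₃₄).swap₃₄.swap₂₃.swap₁₂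
  · exact (IsListed.of_one_conj hb hc hd ha h.swap₁₂.swap₂₃.swap₃₄).swap₃₄.swap₂₃.swap₁₂
  · exact (IsListed.of_two_conj ha hd hb hc hconj.swap₃₄.swap₂₃).swap₂₃.swap₃₄
  · exact (IsListed.of_two_conj ha hc hb hd hconj.swap₂₃).swap₂₃
  · exact (IsListed.of_one_conj ha hc hd hb hconj.swap₂₃.swap₃₄).swap₃₄.swap₂₃
  · exact .of_two_conj ha hb hc hd hconj
  · exact (IsListed.of_one_conj ha hb hd hc hconj.swap₃₄).swap₃₄
  · exact .of_one_conj ha hb hc hd hconj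
  · exact .of_no_conj ha hb hc hd (ne19 hpa) (ne19 hpb) (ne19 hpc) (ne19 hpd) hconj
end

section
/- There exists an 'odd quadruple threat': there are odd prime numbers a, b, c, d, x such that a² + a + 1, b² + b + 1, c² + c + 1, d² + d + 1 are all prime and x² + x + 1 = (a² + a + 1)(b² + b + 1)(c² + c + 1)(d² + d + 1). A witness is a = 39640921169, b = 39640924811, c = 431466989439524477, d = 135601684951723299939542158557248883821, and x = 91939084808732106267276347132638226863579171653778358025126018412980773335493. -/
/-- **Pocklington's criterion**: `n` is prime if some `a` modulo `n` satisfies `a ^ (n - 1) = 1` and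
`a ^ ((n - 1) / q) - 1` is a unit for every prime factor `q` of a divisor `F` of `n - 1` that is
at least of the size of the square root of `n`. -/
theorem Nat.prime_of_isUnit_pow_sub_one {n F R : ℕ} (hn : n = F * R + 1) (hn1 : 1 < n)
    (hF : n < (F + 1) ^ 2) (a : ZMod n) (ha : a ^ (F * R) = 1)
    (hq : ∀ q : ℕ, q.Prime → q ∣ F → IsUnit (a ^ (F / q * R) - 1)) : n.Prime := by
  by_contra hnp
  have hp : n.minFac.Prime := Nat.minFac_prime hn1.ne'
  have : Fact n.minFac.Prime := ⟨hp⟩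
  have hF0 : 0 < F := by
    rcases Nat.eq_zero_or_pos F with rfl | h
    · omega
    · exact h
  set f : ZMod n →+* ZMod n.minFac := ZMod.castHom (Nat.minFac_dvd n) _
  have hb : (f a ^ R) ^ F = 1 := by
    rw [← pow_mul, mul_comm, ← map_pow, ha, map_one]
  have hord : orderOf (f a ^ R) = F := by
    refine orderOf_eq_of_pow_and_pow_div_prime hF0 hb fun q hqp hqF h => ?_
    have hu := (hq q hqp hqF).map f
    rw [map_sub, map_pow, mul_comm, pow_mul, h, map_one, sub_self] at hu
    exact not_isUnit_zero hu
  have hne : f a ^ R ≠ 0 := by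
    intro h
    rw [h, zero_pow hF0.ne'] at hb
    exact zero_ne_one hb
  have hdvd : F ∣ n.minFac - 1 := by
    rw [← hord]
    exact orderOf_dvd_of_pow_eq_one (ZMod.pow_card_sub_one_eq_one hne)
  have hle : F + 1 ≤ n.minFac := by
    have := Nat.le_of_dvd (Nat.sub_pos_of_lt hp.one_lt) hdvd
    have := hp.one_lt
    omega
  have h1 := Nat.minFac_sq_le_self (by omega) hnp
  exact absurd (hF.trans_le ((Nat.pow_le_pow_left hle 2).trans h1)) (lt_irrefl _)

/-- Pocklington's criterion for a prime divisor `q` of `n - 1`. -/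
theorem Nat.prime_of_pow_sub_one_mul_eq_one {n q R : ℕ} (a w : ZMod n) (hq : q.Prime)
    (hn1 : 1 < n) (hn : n = q * R + 1) (hlt : n < (q + 1) ^ 2) (ha : a ^ (q * R) = 1)
    (hw : (a ^ R - 1) * w = 1) : n.Prime := by
  refine Nat.prime_of_isUnit_pow_sub_one hn hn1 hlt a ha fun p hp hpq => ?_
  obtain rfl := (Nat.prime_dvd_prime_iff_eq hp hq).1 hpq
  rw [Nat.div_self hp.pos, one_mul]
  exact IsUnit.of_mul_eq_one _ hw

/-- Pocklington's criterion for a divisor of `n - 1` that is a product of two primes. -/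
theorem Nat.prime_of_pow_sub_one_mul_eq_one_of_mul {n q r R : ℕ} (a w v : ZMod n) (hq : q.Prime)
    (hr : r.Prime) (hn1 : 1 < n) (hn : n = q * r * R + 1) (hlt : n < (q * r + 1) ^ 2)
    (ha : a ^ (q * r * R) = 1) (hw : (a ^ (r * R) - 1) * w = 1)
    (hv : (a ^ (q * R) - 1) * v = 1) : n.Prime := by
  refine Nat.prime_of_isUnit_pow_sub_one hn hn1 hlt a ha fun p hp hpF => ?_
  rcases hp.dvd_mul.1 hpF with h | h
  · obtain rfl := (Nat.prime_dvd_prime_iff_eq hp hq).1 h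
    rw [Nat.mul_div_cancel_left _ hp.pos]
    exact IsUnit.of_mul_eq_one _ hw
  · obtain rfl := (Nat.prime_dvd_prime_iff_eq hp hr).1 h
    rw [Nat.mul_div_cancel _ hp.pos]
    exact IsUnit.of_mul_eq_one _ hv

theorem prime_39640921169 :
    Nat.Prime 39640921169 :=
  Nat.prime_of_pow_sub_one_mul_eq_one_of_mul (q := 4909) (r := 101)
    (R := 79952) 2
    25834703394
    32166103678
    (by norm_num) (by norm_num) (by norm_num) (by norm_num) (by norm_num)
    (by reduce_mod_char) (by reduce_mod_char) (by reduce_mod_char)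

theorem prime_1571402631166513247731 :
    Nat.Prime 1571402631166513247731 :=
  Nat.prime_of_pow_sub_one_mul_eq_one (q := 39640921169)
    (R := 39640921170) 2
    1064755953146623117754
    prime_39640921169 (by norm_num) (by norm_num) (by norm_num)
    (by reduce_mod_char) (by reduce_mod_char)

theorem prime_39640924811 :
    Nat.Prime 39640924811 :=
  Nat.prime_of_pow_sub_one_mul_eq_one (q := 5559737)
    (R := 7130) 2
    33411958171
    (by norm_num) (by norm_num) (by norm_num) (by norm_num)
    (by reduce_mod_char) (by reduce_mod_char)

theorem prime_1571402919910996310533 :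
    Nat.Prime 1571402919910996310533 :=
  Nat.prime_of_pow_sub_one_mul_eq_one (q := 39640924811)
    (R := 39640924812) 2
    428748669408017383207
    prime_39640924811 (by norm_num) (by norm_num) (by norm_num)
    (by reduce_mod_char) (by reduce_mod_char)

theorem prime_7027607489731 :
    Nat.Prime 7027607489731 :=
  Nat.prime_of_pow_sub_one_mul_eq_one_of_mul (q := 7219) (r := 397)
    (R := 2452110) 2
    2592359564415
    2701568866732
    (by norm_num) (by norm_num) (by norm_num) (by norm_num) (by norm_num)
    (by reduce_mod_char) (by reduce_mod_char) (by reduce_mod_char)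

theorem prime_431466989439524477 :
    Nat.Prime 431466989439524477 :=
  Nat.prime_of_pow_sub_one_mul_eq_one (q := 7027607489731)
    (R := 61396) 2
    251509940226211609
    prime_7027607489731 (by norm_num) (by norm_num) (by norm_num)
    (by reduce_mod_char) (by reduce_mod_char)

theorem prime_186163762976006726990628261321648007 :
    Nat.Prime 186163762976006726990628261321648007 :=
  Nat.prime_of_pow_sub_one_mul_eq_one (q := 431466989439524477)
    (R := 431466989439524478) 2
    97593706639289830420845286168533799
    prime_431466989439524477 (by norm_num) (by norm_num) (by norm_num)
    (by reduce_mod_char) (by reduce_mod_char)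

theorem prime_409298377356493 :
    Nat.Prime 409298377356493 :=
  Nat.prime_of_pow_sub_one_mul_eq_one_of_mul (q := 15329) (r := 8123)
    (R := 3287076) 2
    161956292163806
    268856694179900
    (by norm_num) (by norm_num) (by norm_num) (by norm_num) (by norm_num)
    (by reduce_mod_char) (by reduce_mod_char) (by reduce_mod_char)

theorem prime_2875730399306719819 :
    Nat.Prime 2875730399306719819 :=
  Nat.prime_of_pow_sub_one_mul_eq_one (q := 409298377356493)
    (R := 7026) 2
    795519260112081674
    prime_409298377356493 (by norm_num) (by norm_num) (by norm_num)
    (by reduce_mod_char) (by reduce_mod_char)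

theorem prime_135601684951723299939542158557248883821 :
    Nat.Prime 135601684951723299939542158557248883821 :=
  Nat.prime_of_pow_sub_one_mul_eq_one_of_mul (q := 2875730399306719819) (r := 5)
    (R := 9430764788271815156) 2
    114148632394522033010635115588756508266
    52502349825476622165348425363008798480
    prime_2875730399306719819 (by norm_num) (by norm_num) (by norm_num) (by norm_num)
    (by reduce_mod_char) (by reduce_mod_char) (by reduce_mod_char)

theorem prime_18387816961746421253455269426527645372742954667746016265013112114307604443863 :
    Nat.Prime 18387816961746421253455269426527645372742954667746016265013112114307604443863 :=
  Nat.prime_of_pow_sub_one_mul_eq_one (q := 135601684951723299939542158557248883821)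
    (R := 135601684951723299939542158557248883822) 2
    9611637173985467397706167126261935845528093307962684897212413965904796032877
    prime_135601684951723299939542158557248883821 (by norm_num) (by norm_num) (by norm_num)
    (by reduce_mod_char) (by reduce_mod_char)

theorem prime_12173833873 :
    Nat.Prime 12173833873 :=
  Nat.prime_of_pow_sub_one_mul_eq_one_of_mul (q := 104759) (r := 2)
    (R := 58104) 5
    3474210286
    6086916936
    (by norm_num) (by norm_num) (by norm_num) (by norm_num) (by norm_num)
    (by reduce_mod_char) (by reduce_mod_char) (by reduce_mod_char)

theorem prime_106195752200237658974479259 :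
    Nat.Prime 106195752200237658974479259 :=
  Nat.prime_of_pow_sub_one_mul_eq_one_of_mul (q := 12173833873) (r := 10296401)
    (R := 847216346) 2
    101183374426559843253301058
    61221838880987828378866975
    prime_12173833873 (by norm_num) (by norm_num) (by norm_num) (by norm_num)
    (by reduce_mod_char) (by reduce_mod_char) (by reduce_mod_char)

theorem prime_322472860365287007955793324510815824046571 :
    Nat.Prime 322472860365287007955793324510815824046571 :=
  Nat.prime_of_pow_sub_one_mul_eq_one (q := 106195752200237658974479259)
    (R := 3036589069563230) 2
    247904354586166751179410456849953746098409
    prime_106195752200237658974479259 (by norm_num) (by norm_num) (by norm_num)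
    (by reduce_mod_char) (by reduce_mod_char)

theorem prime_15136876065546572153444938652537694780746042741 :
    Nat.Prime 15136876065546572153444938652537694780746042741 :=
  Nat.prime_of_pow_sub_one_mul_eq_one (q := 322472860365287007955793324510815824046571)
    (R := 46940) 2
    11694397647121977735504649238910952173242459720
    prime_322472860365287007955793324510815824046571 (by norm_num) (by norm_num) (by norm_num)
    (by reduce_mod_char) (by reduce_mod_char)

theorem prime_91939084808732106267276347132638226863579171653778358025126018412980773335493 :
    Nat.Prime 91939084808732106267276347132638226863579171653778358025126018412980773335493 :=
  Nat.prime_of_pow_sub_one_mul_eq_one (q := 15136876065546572153444938652537694780746042741)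
    (R := 6073848025881442669529648258612) 2
    50019165672073634244275426391053147339618903298749280938384701446004222842817
    prime_15136876065546572153444938652537694780746042741 (by norm_num) (by norm_num) (by norm_num)
    (by reduce_mod_char) (by reduce_mod_char)

/-- There exists an "odd quadruple threat": odd primes `a, b, c, d, x` with
`Φ₃(a), Φ₃(b), Φ₃(c), Φ₃(d)` all prime and `Φ₃(x) = Φ₃(a)Φ₃(b)Φ₃(c)Φ₃(d)`.
An explicit witness is given. -/
theorem odd_quadruple_threat_exists :
    ∃ a b c d x : ℕ,
      a = 39640921169 ∧ b = 39640924811 ∧ c = 431466989439524477 ∧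
      d = 135601684951723299939542158557248883821 ∧
      x = 91939084808732106267276347132638226863579171653778358025126018412980773335493 ∧
      Odd a ∧ Odd b ∧ Odd c ∧ Odd d ∧ Odd x ∧
      Nat.Prime a ∧ Nat.Prime b ∧ Nat.Prime c ∧ Nat.Prime d ∧ Nat.Prime x ∧
      Nat.Prime (a ^ 2 + a + 1) ∧ Nat.Prime (b ^ 2 + b + 1) ∧
      Nat.Prime (c ^ 2 + c + 1) ∧ Nat.Prime (d ^ 2 + d + 1) ∧
      x ^ 2 + x + 1 =
        (a ^ 2 + a + 1) * (b ^ 2 + b + 1) * (c ^ 2 + c + 1) * (d ^ 2 + d + 1) := by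
  refine ⟨_, _, _, _, _, rfl, rfl, rfl, rfl, rfl, by decide, by decide, by decide, by decide,
    by decide, prime_39640921169, prime_39640924811, prime_431466989439524477,
    prime_135601684951723299939542158557248883821,
    prime_91939084808732106267276347132638226863579171653778358025126018412980773335493,
    ?_, ?_, ?_, ?_, by norm_num⟩
  · convert prime_1571402631166513247731 using 1
    norm_num
  · convert prime_1571402919910996310533 using 1
    norm_num
  · convert prime_186163762976006726990628261321648007 using 1
    norm_num
  · convert
      prime_18387816961746421253455269426527645372742954667746016265013112114307604443863 using 1
    norm_num
end

section
/- Let a, b ≥ 1 be integers such that a + b + 1 divides a·b. Set c = a·b/(a + b + 1) and x = c·(a·b + a + b) + a + b. Then x² + x + 1 = (a² + a + 1)(b² + b + 1)(c² + c + 1). -/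
/-- Verification of the infinite family for three factors: if `a + b + 1` divides `a·b`,
`c = ab/(a+b+1)` and `x = c·(ab+a+b) + a + b`, then
`x² + x + 1 = (a² + a + 1)(b² + b + 1)(c² + c + 1)`. -/
theorem infinite_family_identity (a b : ℕ) (ha : 1 ≤ a) (hb : 1 ≤ b)
    (hdvd : (a + b + 1) ∣ a * b) (c x : ℕ) (hc : c = a * b / (a + b + 1))
    (hx : x = c * (a * b + a + b) + a + b) :
    x ^ 2 + x + 1 = (a ^ 2 + a + 1) * (b ^ 2 + b + 1) * (c ^ 2 + c + 1) := by
  have h : c * (a + b + 1) = a * b := hc ▸ Nat.div_mul_cancel hdvd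
  subst hx
  clear hc
  zify at h ⊢
  linear_combination (c * (a * b - 1) + (a * b + a + b - 1) : ℤ) * h
end
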